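/- There is no positive rational number h such that both 4 + h² and 9 + h² are squares of rational numbers. -/

import Mathlib

/-- A primitive Pythagorean triple with odd first leg, in parametrized form. -/
theorem exists_param_of_odd_leg {x y z : ℤ} (hx : Odd x) (hxy : IsCoprime x y)
    (h : x ^ 2 + y ^ 2 = z ^ 2) :
    ∃ m n : ℤ, IsCoprime m n ∧ (m % 2 = 0 ∧ n % 2 = 1 ∨ m % 2 = 1 ∧ n % 2 = 0) ∧
      x = m ^ 2 - n ^ 2 ∧ y = 2 * m * n := by
  have hx0 : x ≠ 0 := by rintro rfl; simp at hx
  have hz : z ≠ 0 := by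
    rintro rfl
    have := sq_pos_of_ne_zero hx0
    nlinarith [sq_nonneg y]
  have hp : PythagoreanTriple x y |z| := by
    rw [PythagoreanTriple, abs_mul_abs_self]
    linear_combination h
  obtain ⟨m, n, h1, h2, -, h3, h4, -⟩ := hp.coprime_classification'
    (Int.isCoprime_iff_gcd_eq_one.mp hxy) (Int.odd_iff.mp hx) (abs_pos.mpr hz)
  exact ⟨m, n, Int.isCoprime_iff_gcd_eq_one.mpr h3, h4, h1, h2⟩

/-- When the even leg is written `2 * y`, the even parameter can be put first. -/
theorem exists_even_odd_param {x y z : ℤ} (hx : Odd x) (hxy : IsCoprime x y)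
    (h : x ^ 2 + 4 * y ^ 2 = z ^ 2) :
    ∃ m n : ℤ, IsCoprime (2 * m) n ∧ Odd n ∧ x ^ 2 = (4 * m ^ 2 - n ^ 2) ^ 2 ∧
      y = 2 * m * n := by
  have hx2 : IsCoprime x 2 := by
    obtain ⟨j, rfl⟩ := hx
    exact ⟨1, -j, by ring⟩
  obtain ⟨m, n, hmn, hpar, h1, h2⟩ :=
    exists_param_of_odd_leg hx (hx2.mul_right hxy) (z := z) (by linear_combination h)
  rcases hpar with ⟨hm, hn⟩ | ⟨hm, hn⟩
  · obtain ⟨j, rfl⟩ := Int.dvd_of_emod_eq_zero hm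
    exact ⟨j, n, hmn, Int.odd_iff.mpr hn, by rw [h1]; ring, by linarith⟩
  · obtain ⟨j, rfl⟩ := Int.dvd_of_emod_eq_zero hn
    exact ⟨j, m, hmn.symm, Int.odd_iff.mpr hm, by rw [h1]; ring, by linarith⟩

theorem exists_four_factors {m n p q : ℤ} (hm : m ≠ 0) (h : m * n = p * q) :
    ∃ a b c d : ℤ, m = a * b ∧ n = c * d ∧ p = a * c ∧ q = b * d := by
  obtain ⟨a, b, ⟨c, hc⟩, ⟨d, hd⟩, hab⟩ := exists_dvd_and_dvd_of_dvd_mul (Dvd.intro n h)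
  refine ⟨a, b, c, d, hab, mul_left_cancel₀ hm ?_, hc, hd⟩
  rw [h, hc, hd, hab]
  ring

/-- Splitting `4 m² - n² = r p² - s q²` along a common factorization of `m n = p q`. -/
theorem exists_descent_factors {m n p q r s : ℤ} (hrs : r * s = 9) (hm : m ≠ 0)
    (hn : Odd n) (hmn : IsCoprime m n) (hpq : IsCoprime p q) (h : m * n = p * q)
    (he : 4 * m ^ 2 - n ^ 2 = r * p ^ 2 - s * q ^ 2) :
    ∃ a b c d k : ℤ, m = a * b ∧ n = c * d ∧ p = a * c ∧ q = b * d ∧ Odd c ∧ Odd d ∧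
      IsCoprime a c ∧ 4 * b ^ 2 - r * c ^ 2 = k * d ^ 2 ∧ c ^ 2 - s * b ^ 2 = k * a ^ 2 ∧
      (k = 1 ∨ k = -1 ∨ k = 5 ∨ k = -5) := by
  obtain ⟨a, b, c, d, rfl, rfl, rfl, rfl⟩ := exists_four_factors hm h
  have hbc : IsCoprime b c := hmn.of_mul_left_right.of_mul_right_left
  have hac : IsCoprime a c := hmn.of_mul_left_left.of_mul_right_left
  have had : IsCoprime a d := hpq.of_mul_left_left.of_mul_right_right
  obtain ⟨hc, hd⟩ := Int.odd_mul.mp hn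
  have hE : a ^ 2 * (4 * b ^ 2 - r * c ^ 2) = d ^ 2 * (c ^ 2 - s * b ^ 2) := by
    linear_combination he
  obtain ⟨k, hk⟩ : d ^ 2 ∣ 4 * b ^ 2 - r * c ^ 2 :=
    (had.symm.pow (m := 2) (n := 2)).dvd_of_dvd_mul_left (Dvd.intro _ hE.symm)
  have hd0 : d ≠ 0 := by rintro rfl; simp at hd
  have hk' : c ^ 2 - s * b ^ 2 = k * a ^ 2 := by
    apply mul_left_cancel₀ (pow_ne_zero 2 hd0)
    rw [← hE, hk]
    ring
  refine ⟨a, b, c, d, k, rfl, rfl, rfl, rfl, hc, hd, hac, by rw [hk]; ring, hk', ?_⟩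
  obtain ⟨u, v, huv⟩ := hbc.pow (m := 2) (n := 2)
  have hk5 : k ∣ 5 := by
    refine ⟨-(u * (d ^ 2 + r * a ^ 2) + v * (s * d ^ 2 + 4 * a ^ 2)), ?_⟩
    linear_combination (-5) * huv - (u + v * s) * hk - (u * r + 4 * v) * hk' -
      (u * b ^ 2 + v * c ^ 2) * hrs
  have hle := Int.le_of_dvd (by norm_num) hk5
  have hge := Int.le_of_dvd (by norm_num) (neg_dvd.mpr hk5)
  have : -5 ≤ k := by linarith
  interval_cases k <;> revert hk5 <;> decide

theorem sq_emod_three_cases (x : ℤ) : x ^ 2 % 3 = 1 ∨ 3 ∣ x := by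
  rcases (by omega : x % 3 = 0 ∨ x % 3 = 1 ∨ x % 3 = 2) with h | h | h
  · exact Or.inr (Int.dvd_of_emod_eq_zero h)
  all_goals left; simp [pow_two, Int.mul_emod, h]

theorem sq_emod_three_of_dvd {x : ℤ} (h : 3 ∣ x) : x ^ 2 % 3 = 0 :=
  Int.emod_eq_zero_of_dvd (dvd_pow h two_ne_zero)

theorem three_dvd_and_of_dvd_sq_add_sq {x y : ℤ} (h : 3 ∣ x ^ 2 + y ^ 2) : 3 ∣ x ∧ 3 ∣ y := by
  rcases sq_emod_three_cases x with hx | hx <;> rcases sq_emod_three_cases y with hy | hy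
  · omega
  · have := sq_emod_three_of_dvd hy; omega
  · have := sq_emod_three_of_dvd hx; omega
  · exact ⟨hx, hy⟩

theorem sq_emod_eight_cases (x : ℤ) : x ^ 2 % 8 = 0 ∨ x ^ 2 % 8 = 1 ∨ x ^ 2 % 8 = 4 := by
  have h : x % 8 = 0 ∨ x % 8 = 1 ∨ x % 8 = 2 ∨ x % 8 = 3 ∨ x % 8 = 4 ∨ x % 8 = 5 ∨
      x % 8 = 6 ∨ x % 8 = 7 := by omega
  rcases h with h | h | h | h | h | h | h | h <;> simp [pow_two, Int.mul_emod, h]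

theorem not_isCoprime_of_three_dvd {x y : ℤ} (hx : 3 ∣ x) (hy : 3 ∣ y) : ¬ IsCoprime x y := by
  intro h
  have := Int.isUnit_iff.mp (h.isUnit_of_dvd' hx hy)
  omega

/-- The case in which `3` divides the numerator is excluded by congruences. -/
theorem four_mul_sq_sub_sq_sq_ne {m n p q : ℤ} (hm : m ≠ 0) (hn : Odd n)
    (hmn : IsCoprime m n) (hpq : IsCoprime p q) (h : m * n = p * q) :
    (4 * m ^ 2 - n ^ 2) ^ 2 ≠ (3 * (p ^ 2 - q ^ 2)) ^ 2 := by
  intro he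
  rcases sq_eq_sq_iff_eq_or_eq_neg.mp he with he | he
  · obtain ⟨a, b, c, d, k, -, -, -, -, hc, hd, hac, h1, h2, hk⟩ :=
      exists_descent_factors (r := 3) (s := 3) (by norm_num) hm hn hmn hpq h
        (by linear_combination he)
    have hc4 := Int.sq_mod_four_eq_one_of_odd hc
    have hd4 := Int.sq_mod_four_eq_one_of_odd hd
    rcases hk with rfl | rfl | rfl | rfl
    · have ha := sq_emod_eight_cases a
      have hb := sq_emod_eight_cases b
      have hc := sq_emod_eight_cases c
      have hd := sq_emod_eight_cases d
      omega
    · omega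
    · obtain ⟨ha, hc⟩ := three_dvd_and_of_dvd_sq_add_sq (x := a) (y := c) (by omega)
      exact not_isCoprime_of_three_dvd ha hc hac
    · omega
  · obtain ⟨a, b, c, d, k, -, -, -, -, hc, hd, hac, h1, h2, hk⟩ :=
      exists_descent_factors (r := -3) (s := -3) (by norm_num) hm hn hmn hpq h
        (by linear_combination he)
    have hc4 := Int.sq_mod_four_eq_one_of_odd hc
    have hd4 := Int.sq_mod_four_eq_one_of_odd hd
    have hb0 := sq_nonneg b
    have hc0 := sq_nonneg c
    have hd0 := sq_nonneg d
    rcases hk with rfl | rfl | rfl | rfl <;> omega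

/-- The case in which `3` divides the denominator leads back to the same pair of equations. -/
theorem exists_smaller_solution {m n p q : ℤ} (hm : m ≠ 0) (hn : Odd n)
    (hmn : IsCoprime m n) (hpq : IsCoprime (3 * p) q) (h : m * n = p * q)
    (he : (4 * m ^ 2 - n ^ 2) ^ 2 = ((3 * p) ^ 2 - q ^ 2) ^ 2) :
    ∃ x y z w : ℤ, Odd x ∧ y ∣ m ∧ x ^ 2 + 4 * y ^ 2 = z ^ 2 ∧ x ^ 2 + 9 * y ^ 2 = w ^ 2 := by
  have hpq' : IsCoprime p q := hpq.of_mul_left_right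
  have hq3 : ¬ 3 ∣ q := fun hq => not_isCoprime_of_three_dvd (Dvd.intro _ rfl) hq hpq
  rcases sq_eq_sq_iff_eq_or_eq_neg.mp he with he | he
  · obtain ⟨a, b, c, d, k, hm', -, -, hq, hc, hd, -, h1, h2, hk⟩ :=
      exists_descent_factors (r := 9) (s := 1) (by norm_num) hm hn hmn hpq' h
        (by linear_combination he)
    have hc4 := Int.sq_mod_four_eq_one_of_odd hc
    have hd4 := Int.sq_mod_four_eq_one_of_odd hd
    rcases hk with rfl | rfl | rfl | rfl
    · omega
    · have hb := (three_dvd_and_of_dvd_sq_add_sq (x := b) (y := d) (by omega)).1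
      exact absurd (hq ▸ hb.mul_right d) hq3
    · omega
    · exact ⟨d, a, c, b, hd, hm' ▸ Dvd.intro _ rfl, by linarith, by linarith⟩
  · obtain ⟨a, b, c, d, k, hm', -, -, hq, hc, hd, -, h1, h2, hk⟩ :=
      exists_descent_factors (r := -9) (s := -1) (by norm_num) hm hn hmn hpq' h
        (by linear_combination he)
    have hc4 := Int.sq_mod_four_eq_one_of_odd hc
    have hd4 := Int.sq_mod_four_eq_one_of_odd hd
    rcases hk with rfl | rfl | rfl | rfl
    · refine ⟨3 * c, b, d, 3 * a, Odd.mul (by decide) hc, hm' ▸ Dvd.intro_left _ rfl, ?_, ?_⟩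
      · linear_combination h1
      · linear_combination 9 * h2
    · omega
    · have hb := (three_dvd_and_of_dvd_sq_add_sq (x := b) (y := d) (by omega)).1
      exact absurd (hq ▸ hb.mul_right d) hq3
    · omega

/-- Descent step for coprime solutions. -/
theorem exists_smaller_solution_of_isCoprime {x y z w : ℤ} (hx : Odd x) (hy : y ≠ 0)
    (hxy : IsCoprime x y) (hz : x ^ 2 + 4 * y ^ 2 = z ^ 2) (hw : x ^ 2 + 9 * y ^ 2 = w ^ 2) :
    ∃ x' y' z' w' : ℤ, Odd x' ∧ y' ≠ 0 ∧ y'.natAbs < y.natAbs ∧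
      x' ^ 2 + 4 * y' ^ 2 = z' ^ 2 ∧ x' ^ 2 + 9 * y' ^ 2 = w' ^ 2 := by
  obtain ⟨m, n, hmn, hn, hx2, hymn⟩ := exists_even_odd_param hx hxy hz
  have hmn' : IsCoprime m n := hmn.of_mul_left_right
  have hm : m ≠ 0 := by rintro rfl; simp at hymn; exact hy hymn
  by_cases h3 : 3 ∣ x
  · exfalso
    obtain ⟨x, rfl⟩ := h3
    obtain ⟨w, rfl⟩ : 3 ∣ w :=
      Int.prime_three.dvd_of_dvd_pow ⟨3 * x ^ 2 + 3 * y ^ 2, by rw [← hw]; ring⟩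
    obtain ⟨p, q, hpq, -, h1, h2⟩ := exists_param_of_odd_leg (x := x) (y := y) (z := w)
      (Int.odd_mul.mp hx).2 hxy.of_mul_left_right (by linarith)
    refine four_mul_sq_sub_sq_sq_ne hm hn hmn' hpq (by linarith) ?_
    rw [← hx2, h1]
  · have hx3 : IsCoprime x 3 :=
      ((Int.prime_three.coprime_iff_not_dvd).mpr h3).symm
    obtain ⟨p, q, hpq, -, h1, h2⟩ := exists_param_of_odd_leg hx (hx3.mul_right hxy)
      (z := w) (by linear_combination hw)
    have h3mn : 3 * (m * n) = p * q := by linarith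
    obtain ⟨x', y', z', w', hx', hym, hz', hw'⟩ : ∃ x y z w : ℤ, Odd x ∧ y ∣ m ∧
        x ^ 2 + 4 * y ^ 2 = z ^ 2 ∧ x ^ 2 + 9 * y ^ 2 = w ^ 2 := by
      rcases Int.prime_three.dvd_or_dvd (Dvd.intro _ h3mn) with ⟨p, rfl⟩ | ⟨q, rfl⟩
      · refine exists_smaller_solution hm hn hmn' hpq (by linarith) ?_
        rw [← hx2, h1]
      · refine exists_smaller_solution hm hn hmn' hpq.symm (q := p) (by linarith) ?_
        rw [← hx2, h1]
        ring
    have hy' : y' ≠ 0 := by rintro rfl; exact hm (zero_dvd_iff.mp hym)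
    refine ⟨x', y', z', w', hx', hy', ?_, hz', hw'⟩
    have hle : y'.natAbs ≤ m.natAbs := Int.natAbs_le_of_dvd_ne_zero hym hm
    have hmy : (2 * m).natAbs ≤ y.natAbs :=
      Int.natAbs_le_of_dvd_ne_zero (Dvd.intro _ hymn.symm) hy
    omega

/-- The forms `x² + 4y²` and `x² + 9y²` are not both squares for `x` odd and `y` nonzero. -/
theorem not_both_squares_of_odd {x y z w : ℤ} (hx : Odd x) (hy : y ≠ 0)
    (hz : x ^ 2 + 4 * y ^ 2 = z ^ 2) (hw : x ^ 2 + 9 * y ^ 2 = w ^ 2) : False := by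
  induction hN : y.natAbs using Nat.strong_induction_on generalizing x y z w with
  | _ N ih =>
    subst hN
    obtain ⟨g, x₀, y₀, hg, hcop, hx₀, hy₀⟩ :
        ∃ g x₀ y₀ : ℤ, g ≠ 0 ∧ IsCoprime x₀ y₀ ∧ x = g * x₀ ∧ y = g * y₀ := by
      have hpos : 0 < Int.gcd x y := Int.gcd_pos_of_ne_zero_right x hy
      obtain ⟨x₀, y₀, hcop, h1, h2⟩ := Int.exists_gcd_one hpos
      exact ⟨Int.gcd x y, x₀, y₀, by exact_mod_cast hpos.ne',
        Int.isCoprime_iff_gcd_eq_one.mpr hcop, by linarith, by linarith⟩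
    subst hx₀ hy₀
    have hy0 : y₀ ≠ 0 := right_ne_zero_of_mul hy
    obtain ⟨z, rfl⟩ : g ∣ z := (Int.pow_dvd_pow_iff two_ne_zero).mp
      ⟨x₀ ^ 2 + 4 * y₀ ^ 2, by rw [← hz]; ring⟩
    obtain ⟨w, rfl⟩ : g ∣ w := (Int.pow_dvd_pow_iff two_ne_zero).mp
      ⟨x₀ ^ 2 + 9 * y₀ ^ 2, by rw [← hw]; ring⟩
    have hg2 : g ^ 2 ≠ 0 := pow_ne_zero 2 hg
    obtain ⟨x', y', z', w', hx', hy', hlt, hz', hw'⟩ :=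
      exists_smaller_solution_of_isCoprime (Int.odd_mul.mp hx).2 hy0 hcop
        (mul_left_cancel₀ hg2 (by linear_combination hz : _ = g ^ 2 * z ^ 2))
        (mul_left_cancel₀ hg2 (by linear_combination hw : _ = g ^ 2 * w ^ 2))
    refine ih _ (hlt.trans_le ?_) hx' hy' hz' hw' rfl
    exact Int.natAbs_le_of_dvd_ne_zero (Dvd.intro_left _ rfl) hy

theorem exists_int_sq_eq_of_rat {N : ℤ} {r : ℚ} (h : (N : ℚ) = r ^ 2) :
    ∃ z : ℤ, N = z ^ 2 := by
  have : IsSquare (N : ℚ) := ⟨r, by rw [h, pow_two]⟩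
  obtain ⟨z, hz⟩ := Rat.isSquare_intCast_iff.mp this
  exact ⟨z, by rw [hz, pow_two]⟩

/-- There is no positive rational `h` with both `4 + h²` and `9 + h²` rational squares. -/
theorem no_common_height_two_three :
    ¬ ∃ h : ℚ, 0 < h ∧ (∃ s : ℚ, 4 + h ^ 2 = s ^ 2) ∧ (∃ t : ℚ, 9 + h ^ 2 = t ^ 2) := by
  rintro ⟨h, hpos, ⟨s, hs⟩, ⟨t, ht⟩⟩
  have hden : (h.den : ℤ) ≠ 0 := by exact_mod_cast h.den_nz
  have hnum : h.num ≠ 0 := Rat.num_ne_zero.mpr hpos.ne'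
  have hcop : IsCoprime h.num (h.den : ℤ) := Int.isCoprime_iff_nat_coprime.mpr h.reduced
  have hmul : h * h.den = h.num := Rat.mul_den_eq_num h
  obtain ⟨z, hz⟩ : ∃ z : ℤ, h.num ^ 2 + 4 * (h.den : ℤ) ^ 2 = z ^ 2 := by
    apply exists_int_sq_eq_of_rat (r := s * h.den)
    push_cast
    rw [← hmul]
    linear_combination (h.den : ℚ) ^ 2 * hs
  obtain ⟨w, hw⟩ : ∃ w : ℤ, h.num ^ 2 + 9 * (h.den : ℤ) ^ 2 = w ^ 2 := by
    apply exists_int_sq_eq_of_rat (r := t * h.den)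
    push_cast
    rw [← hmul]
    linear_combination (h.den : ℚ) ^ 2 * ht
  generalize h.num = x at *
  generalize (h.den : ℤ) = y at *
  rcases Int.even_or_odd x with hx | hx
  · have hy : Odd y := by
      by_contra hy
      obtain ⟨j, rfl⟩ := Int.not_odd_iff_even.mp hy |>.two_dvd
      obtain ⟨i, rfl⟩ := hx.two_dvd
      have := Int.isUnit_iff.mp (hcop.isUnit_of_dvd' (Dvd.intro _ rfl) (Dvd.intro _ rfl))
      omega
    obtain ⟨i, rfl⟩ := hx.two_dvd
    obtain ⟨z, rfl⟩ : 2 ∣ z :=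
      Int.prime_two.dvd_of_dvd_pow ⟨2 * i ^ 2 + 2 * y ^ 2, by rw [← hz]; ring⟩
    -- the substitution `h ↦ 6 / h` makes the numerator odd
    refine not_both_squares_of_odd (x := 3 * y) (y := i) (z := w) (w := 3 * z)
      (Odd.mul (by decide) hy) (right_ne_zero_of_mul hnum) ?_ ?_
    · linear_combination hw
    · linarith
  · exact not_both_squares_of_odd hx hden hz hw
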